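/- arXiv:2210.12291 — 2 statements merged into one kernel-verified Lean document; each statement's English description precedes it below -/
import Mathlib

section
/- Let $k, t, a_1, a_2, \dots, a_t$ be positive integers such that $t \ge 4$ is even and $\frac{2k}{t-1} \le a_1 \le a_2 \le \dots \le a_t$. Then the rainbow $k$-connection number of the complete $t$-partite graph $K_{a_1, a_2, \dots, a_t}$ satisfies $\mathrm{rc}_k(K_{a_1, a_2, \dots, a_t}) \le 3$. -/
open SimpleGraph

/-- A walk in an edge-colored graph is *rainbow* (under the edge coloring `c`) if no color
appears on more than one of its edges. -/
def SimpleGraph.Walk.IsRainbow {V α : Type*} {G : SimpleGraph V} {u v : V}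
    (c : Sym2 V → α) (p : G.Walk u v) : Prop :=
  (p.edges.map c).Nodup

/-- The edge coloring `c` makes `G` *rainbow `k`-connected*: every pair of distinct vertices
is connected by `k` pairwise distinct, pairwise internally vertex-disjoint rainbow paths. -/
def IsRainbowConnectedColoring {V α : Type*} (G : SimpleGraph V) (k : ℕ)
    (c : Sym2 V → α) : Prop :=
  ∀ u v : V, u ≠ v → ∃ P : Fin k → G.Walk u v,
    Function.Injective P ∧
    (∀ i, (P i).IsPath ∧ (P i).IsRainbow c) ∧
    (∀ i j, i ≠ j → ∀ w, w ∈ (P i).support → w ∈ (P j).support → w = u ∨ w = v)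

/-- `RCle G k ℓ` says that the rainbow `k`-connection number of `G` is at most `ℓ`, i.e.
there is an edge coloring with `ℓ` colors making `G` rainbow `k`-connected. -/
def RCle {V : Type*} (G : SimpleGraph V) (k ℓ : ℕ) : Prop :=
  ∃ c : Sym2 V → Fin ℓ, IsRainbowConnectedColoring G k c


/-- Color of an edge between part `i` and part `j`. -/
def partCol (i j : ℕ) : Fin 3 :=
  if i / 2 = j / 2 then 2 else if (i + j) % 2 = 0 then 0 else 1

theorem partCol_comm (i j : ℕ) : partCol i j = partCol j i := by
  unfold partCol
  simp only [eq_comm (a := i / 2), Nat.add_comm i j]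

/-- The coloring of the multipartite graph. -/
def vertCol {t : ℕ} (a : Fin t → ℕ) : Sym2 (Σ i, Fin (a i)) → Fin 3 :=
  Sym2.lift ⟨fun u v => partCol u.1.1 v.1.1, fun _ _ => partCol_comm _ _⟩

/-- Abstract condition for a path `u, x, y, v` (or `u, x, v` when `x = y`), at the level
of part indices. -/
def GoodIdx (i j fi fx gi gx : ℕ) : Prop :=
  fi ≠ i ∧ fi ≠ j ∧ gi ≠ i ∧ gi ≠ j ∧
  ((fi = gi ∧ fx = gx ∧ partCol i fi ≠ partCol fi j) ∨
   (fi ≠ gi ∧ partCol i fi ≠ partCol fi gi ∧ partCol i fi ≠ partCol gi j ∧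
     partCol fi gi ≠ partCol gi j))

theorem exists_walk {t : ℕ} (a : Fin t → ℕ) (u v x y : Σ i, Fin (a i)) (huv : u ≠ v)
    (h : GoodIdx u.1.1 v.1.1 x.1.1 x.2.1 y.1.1 y.2.1) :
    ∃ P : (completeMultipartiteGraph (fun i => Fin (a i))).Walk u v,
      P.IsPath ∧ P.IsRainbow (vertCol a) ∧ x ∈ P.support ∧ x ≠ u ∧ x ≠ v ∧
      ∀ w ∈ P.support, w = u ∨ w = v ∨ w = x ∨ w = y := by
  obtain ⟨h1, h2, h3, h4, h5⟩ := h
  have n1 : x ≠ u := fun e => h1 (by rw [e])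
  have n2 : x ≠ v := fun e => h2 (by rw [e])
  have n3 : y ≠ u := fun e => h3 (by rw [e])
  have n4 : y ≠ v := fun e => h4 (by rw [e])
  have aux : (completeMultipartiteGraph (fun i => Fin (a i))).Adj u x := by
    intro e; exact h1 (congrArg Fin.val e).symm
  have ayv : (completeMultipartiteGraph (fun i => Fin (a i))).Adj y v := by
    intro e; exact h4 (congrArg Fin.val e)
  rcases h5 with ⟨e1, e2, e3⟩ | ⟨d1, d2, d3, d4⟩
  · have axv : (completeMultipartiteGraph (fun i => Fin (a i))).Adj x v := by
      intro e; exact h2 (congrArg Fin.val e)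
    refine ⟨Walk.cons aux (Walk.cons axv Walk.nil), ?_, ?_, ?_, n1, n2, ?_⟩
    · simp [n1.symm, n2, huv]
    · simpa [Walk.IsRainbow, vertCol] using e3
    · simp
    · intro w hw
      simp at hw
      tauto
  · have axy : (completeMultipartiteGraph (fun i => Fin (a i))).Adj x y := by
      intro e; exact d1 (congrArg Fin.val e)
    have nxy : x ≠ y := fun e => d1 (by rw [e])
    refine ⟨Walk.cons aux (Walk.cons axy (Walk.cons ayv Walk.nil)), ?_, ?_, ?_, n1, n2, ?_⟩
    · simp [n1.symm, n2, huv, n3.symm, n4, nxy]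
    · simp [Walk.IsRainbow, vertCol]
      tauto
    · simp
    · intro w hw
      simp at hw
      tauto

theorem exists_paths {t k A : ℕ} (a : Fin t → ℕ) (hA : ∀ i, A ≤ a i)
    (u v : Σ i, Fin (a i)) (huv : u ≠ v) {ι : Type} [Fintype ι] (hk : k ≤ Fintype.card ι)
    (fi fx gi gx : ι → ℕ) (hfi : ∀ z, fi z < t) (hgi : ∀ z, gi z < t)
    (hfx : ∀ z, fx z < A) (hgx : ∀ z, gx z < A)
    (good : ∀ z, GoodIdx u.1.1 v.1.1 (fi z) (fx z) (gi z) (gx z))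
    (dff : ∀ z z', fi z = fi z' → fx z = fx z' → z = z')
    (dfg : ∀ z z', fi z = gi z' → fx z = gx z' → z = z')
    (dgg : ∀ z z', gi z = gi z' → gx z = gx z' → z = z') :
    ∃ P : Fin k → (completeMultipartiteGraph (fun i => Fin (a i))).Walk u v,
      Function.Injective P ∧
      (∀ i, (P i).IsPath ∧ (P i).IsRainbow (vertCol a)) ∧
      (∀ i j, i ≠ j → ∀ w, w ∈ (P i).support → w ∈ (P j).support → w = u ∨ w = v) := by
  let F : ι → Σ i, Fin (a i) := fun z => ⟨⟨fi z, hfi z⟩, ⟨fx z, (hfx z).trans_le (hA _)⟩⟩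
  let G : ι → Σ i, Fin (a i) := fun z => ⟨⟨gi z, hgi z⟩, ⟨gx z, (hgx z).trans_le (hA _)⟩⟩
  have key : ∀ p q : Σ i, Fin (a i), p = q → p.1.1 = q.1.1 ∧ p.2.1 = q.2.1 := by
    rintro p q rfl; exact ⟨rfl, rfl⟩
  have hFF : ∀ z z', F z = F z' → z = z' := fun z z' e =>
    dff z z' (key _ _ e).1 (key _ _ e).2
  have hFG : ∀ z z', F z = G z' → z = z' := fun z z' e =>
    dfg z z' (key _ _ e).1 (key _ _ e).2
  have hGG : ∀ z z', G z = G z' → z = z' := fun z z' e =>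
    dgg z z' (key _ _ e).1 (key _ _ e).2
  choose W hp hr hx hxu hxv hs using fun z => exists_walk a u v (F z) (G z) huv (good z)
  obtain ⟨e⟩ : Nonempty (Fin k ↪ ι) :=
    Function.Embedding.nonempty_of_card_le (by simpa using hk)
  have disj : ∀ i j, i ≠ j → ∀ w, w ∈ (W (e i)).support → w ∈ (W (e j)).support →
      w = u ∨ w = v := by
    intro i j hij w hi hj
    have hne : e i ≠ e j := fun h => hij (e.injective h)
    rcases hs _ w hi with h | h | h | h
    · exact Or.inl h
    · exact Or.inr h
    · rcases hs _ w hj with h' | h' | h' | h'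
      · exact Or.inl h'
      · exact Or.inr h'
      · exact absurd (hFF _ _ (h.symm.trans h')) hne
      · exact absurd (hFG _ _ (h.symm.trans h')) hne
    · rcases hs _ w hj with h' | h' | h' | h'
      · exact Or.inl h'
      · exact Or.inr h'
      · exact absurd (hFG _ _ (h'.symm.trans h)) hne.symm
      · exact absurd (hGG _ _ (h.symm.trans h')) hne
  refine ⟨fun i => W (e i), ?_, fun i => ⟨hp _, hr _⟩, disj⟩
  intro i j hij
  by_contra hne
  have h1 := hx (e i)
  have h2 : F (e i) ∈ (W (e j)).support := by
    have hij' : W (e i) = W (e j) := hij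
    rw [← hij']; exact h1
  rcases disj i j hne _ h1 h2 with h | h
  · exact hxu _ h
  · exact hxv _ h

/-- Two-edge paths. -/
theorem good_single {i j l x : ℕ} (hli : l ≠ i) (hlj : l ≠ j)
    (h : (i + j) % 2 = 1 ∨ (i / 2 ≠ j / 2 ∧ (l / 2 = i / 2 ∨ l / 2 = j / 2))) :
    GoodIdx i j l x l x := by
  refine ⟨hli, hlj, hli, hlj, Or.inl ⟨rfl, rfl, ?_⟩⟩
  unfold partCol
  split_ifs <;> simp <;> omega

/-- Three-edge paths through another pair of parts. -/
theorem good_pair {i j m x y : ℕ} (hi : m ≠ i / 2) (hj : m ≠ j / 2)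
    (h : (i + j) % 2 = 0) : GoodIdx i j (2 * m) x (2 * m + 1) y := by
  refine ⟨by omega, by omega, by omega, by omega, Or.inr ⟨by omega, ?_, ?_, ?_⟩⟩ <;>
  · unfold partCol
    split_ifs <;> simp <;> omega

/-- Three-edge paths using the partner part of `i`. -/
theorem good_partner {i l q x y : ℕ} (hl : l / 2 ≠ i / 2) (hq : q / 2 = i / 2) (hqi : q ≠ i) :
    GoodIdx i i l x q y := by
  refine ⟨by omega, by omega, by omega, by omega, Or.inr ⟨by omega, ?_, ?_, ?_⟩⟩ <;>
  · unfold partCol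
    split_ifs <;> simp <;> omega

theorem rc_k_even_multipartite_le_three (k t : ℕ) (a : Fin t → ℕ)
    (hk : 0 < k) (ht : 4 ≤ t) (hteven : Even t)
    (hapos : ∀ i, 0 < a i) (hmono : Monotone a)
    (hlb : 2 * k ≤ a ⟨0, by omega⟩ * (t - 1)) :
    RCle (completeMultipartiteGraph (fun i => Fin (a i))) k 3 := by
  refine ⟨vertCol a, ?_⟩
  intro u v huv
  obtain ⟨s, hs⟩ := hteven
  have hA : ∀ i, a ⟨0, by omega⟩ ≤ a i := fun i => hmono (Fin.mk_le_mk.2 (Nat.zero_le _))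
  generalize a ⟨0, by omega⟩ = A at hlb hA
  obtain ⟨i, hi⟩ : ∃ i, i = u.1.1 := ⟨_, rfl⟩
  obtain ⟨j, hj⟩ : ∃ j, j = v.1.1 := ⟨_, rfl⟩
  have hit : i < t := hi ▸ u.1.2
  have hjt : j < t := hj ▸ v.1.2
  have hs2 : 2 ≤ s := by omega
  by_cases hij : i = j
  · -- same part
    obtain ⟨p, hps, hpi⟩ : ∃ p, p < s ∧ p ≠ i / 2 := by
      by_cases h : i / 2 = 0
      · exact ⟨1, by omega, by omega⟩
      · exact ⟨0, by omega, by omega⟩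
    obtain ⟨q, hq, hqi⟩ : ∃ q, q / 2 = i / 2 ∧ q ≠ i :=
      ⟨4 * (i / 2) + 1 - i, by omega, by omega⟩
    refine exists_paths (A := A) a hA u v huv
      (ι := ({m : Fin s // m ≠ ⟨i / 2, by omega⟩} × Fin A) ⊕ Fin (A / 2)) ?_
      (Sum.elim (fun z => 2 * z.1.1.1) (fun _ => 2 * p + 1))
      (Sum.elim (fun z => z.2.1) (fun x => x.1))
      (Sum.elim (fun z => if z.1.1.1 = p ∧ z.2.1 < A / 2 then q else 2 * z.1.1.1 + 1)
        (fun _ => q))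
      (Sum.elim (fun z => z.2.1) (fun x => x.1 + A / 2))
      ?_ ?_ ?_ ?_ ?_ ?_ ?_ ?_
    · have hc : Fintype.card {m : Fin s // m ≠ ⟨i / 2, by omega⟩} = s - 1 := by
        rw [Fintype.card_subtype_compl]; simp
      rw [Fintype.card_sum, Fintype.card_prod, hc]
      simp only [Fintype.card_fin]
      obtain ⟨r, rfl⟩ : ∃ r, s = r + 1 := ⟨s - 1, by omega⟩
      have e : t - 1 = 2 * r + 1 := by omega
      rw [e, Nat.mul_add, Nat.mul_left_comm, Nat.mul_comm A r] at hlb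
      simp only [Nat.add_sub_cancel]
      omega
    · rintro (⟨⟨m, hm⟩, x⟩ | x) <;> simp <;> omega
    · rintro (⟨⟨m, hm⟩, x⟩ | x) <;> simp <;> (try split_ifs) <;> omega
    · rintro (⟨⟨m, hm⟩, x⟩ | x) <;> simp <;> omega
    · rintro (⟨⟨m, hm⟩, x⟩ | x) <;> simp <;> omega
    · rw [← hi, show v.1.1 = i from (hij.trans hj).symm]
      rintro (⟨⟨m, hm⟩, x⟩ | x)
      · have hm' : m.1 ≠ i / 2 := fun e => hm (Fin.ext e)
        simp only [Sum.elim_inl]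
        split_ifs
        · exact good_partner (by omega) hq hqi
        · exact good_pair hm' hm' (by omega)
      · exact good_partner (by simp only [Sum.elim_inr]; omega) hq hqi
    · rintro (⟨⟨⟨m, hm0⟩, hm⟩, x⟩ | x) (⟨⟨⟨m', hm0'⟩, hm'⟩, x'⟩ | x') <;>
        simp [Fin.ext_iff] <;> (try simp [Fin.ext_iff] at hm) <;> (try simp [Fin.ext_iff] at hm') <;> omega
    · rintro (⟨⟨⟨m, hm0⟩, hm⟩, x⟩ | x) (⟨⟨⟨m', hm0'⟩, hm'⟩, x'⟩ | x') <;>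
        simp [Fin.ext_iff] <;> (try simp [Fin.ext_iff] at hm) <;> (try simp [Fin.ext_iff] at hm') <;>
        (try split_ifs) <;> omega
    · rintro (⟨⟨⟨m, hm0⟩, hm⟩, x⟩ | x) (⟨⟨⟨m', hm0'⟩, hm'⟩, x'⟩ | x') <;>
        simp [Fin.ext_iff] <;> (try simp [Fin.ext_iff] at hm) <;> (try simp [Fin.ext_iff] at hm') <;>
        (try split_ifs) <;> omega
  · have hkA : k ≤ s * A := by
      have h1 : A * (t - 1) ≤ A * (2 * s) := Nat.mul_le_mul_left _ (by omega)
      have h2 : A * (2 * s) = 2 * (s * A) := by ring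
      omega
    by_cases hpar : (i + j) % 2 = 1
    · refine exists_paths (A := A) a hA u v huv
        (ι := {l : Fin t // ¬ (l = ⟨i, hit⟩ ∨ l = ⟨j, hjt⟩)} × Fin A) ?_
        (fun z => z.1.1.1) (fun z => z.2.1) (fun z => z.1.1.1) (fun z => z.2.1)
        (fun z => z.1.1.2) (fun z => z.1.1.2) (fun z => z.2.2) (fun z => z.2.2) ?_ ?_ ?_ ?_
      · have hc : t - 2 ≤ Fintype.card {l : Fin t // ¬ (l = ⟨i, hit⟩ ∨ l = ⟨j, hjt⟩)} := by
          rw [Fintype.card_subtype_compl, Fintype.card_fin]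
          have := Fintype.card_subtype_or (fun l : Fin t => l = ⟨i, hit⟩) (fun l => l = ⟨j, hjt⟩)
          simp only [Fintype.card_subtype_eq] at this
          omega
        rw [Fintype.card_prod, Fintype.card_fin]
        exact hkA.trans (Nat.mul_le_mul_right _ (by omega))
      · rw [← hi, ← hj]
        rintro ⟨⟨l, hl⟩, x⟩
        rw [not_or] at hl
        exact good_single (fun e => hl.1 (Fin.ext e)) (fun e => hl.2 (Fin.ext e)) (Or.inl hpar)
      all_goals
        rintro ⟨⟨l, hl⟩, x⟩ ⟨⟨l', hl'⟩, x'⟩ h1 h2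
        obtain rfl := Fin.ext h1
        obtain rfl := Fin.ext h2
        rfl
    · have hd : i / 2 ≠ j / 2 := by omega
      obtain ⟨i', hi1, hi2⟩ : ∃ q, q / 2 = i / 2 ∧ q ≠ i :=
        ⟨4 * (i / 2) + 1 - i, by omega, by omega⟩
      obtain ⟨j', hj1, hj2⟩ : ∃ q, q / 2 = j / 2 ∧ q ≠ j :=
        ⟨4 * (j / 2) + 1 - j, by omega, by omega⟩
      refine exists_paths (A := A) a hA u v huv (ι := Fin s × Fin A) ?_
        (fun z => if z.1.1 = i / 2 then i' else if z.1.1 = j / 2 then j' else 2 * z.1.1)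
        (fun z => z.2.1)
        (fun z => if z.1.1 = i / 2 then i' else if z.1.1 = j / 2 then j' else 2 * z.1.1 + 1)
        (fun z => z.2.1) ?_ ?_ (fun z => z.2.2) (fun z => z.2.2) ?_ ?_ ?_ ?_
      · simpa using hkA
      · rintro ⟨m, x⟩; dsimp only; split_ifs <;> omega
      · rintro ⟨m, x⟩; dsimp only; split_ifs <;> omega
      · rw [← hi, ← hj]
        rintro ⟨m, x⟩
        dsimp only
        split_ifs with h1 h2
        · exact good_single hi2 (by omega) (Or.inr ⟨hd, Or.inl hi1⟩)
        · exact good_single (by omega) hj2 (Or.inr ⟨hd, Or.inr hj1⟩)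
        · exact good_pair h1 h2 (by omega)
      all_goals
        rintro ⟨m, x⟩ ⟨m', x'⟩ h1 h2
        obtain rfl := Fin.ext h2
        have : m.1 = m'.1 := by
          dsimp only at h1
          split_ifs at h1 <;> omega
        obtain rfl := Fin.ext this
        rfl
end

section
/- The rainbow $2$-connection number of the complete tripartite graph $K_{2,4,16}$ equals $2$; that is, there exists an edge coloring of $K_{2,4,16}$ with $2$ colors under which every pair of distinct vertices is connected by two internally disjoint rainbow paths, and no coloring with fewer colors achieves this. -/
open SimpleGraph

/-- The graph `K_{2,4,16}`. -/
abbrev KG : SimpleGraph (Σ i, (![Fin 2, Fin 4, Fin 16] : Fin 3 → Type) i) :=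
  completeMultipartiteGraph ![Fin 2, Fin 4, Fin 16]

/-- Bitmask rows of the symmetric colour matrix (vertices numbered 0-1, 2-5, 6-21). -/
def colorRow (x : ℕ) : ℕ :=
  [3966748, 3966752, 3088705, 1723201, 1907777, 2651714, 60, 0, 15, 43, 51, 24, 48, 36, 40, 3,
    20, 12, 23, 63, 27, 39].getD x 0

def colF (x y : Fin 22) : Fin 2 := if (colorRow x.1).testBit y.1 then 1 else 0

def partN (x : Fin 22) : Fin 3 := if x.1 < 2 then 0 else if x.1 < 6 then 1 else 2

theorem colF_symm : ∀ x y, colF x y = colF y x := by decide +kernel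

/-- `w` is the middle of a rainbow path of length two. -/
def GoodMid (x y w : Fin 22) : Prop :=
  partN x ≠ partN w ∧ partN w ≠ partN y ∧ colF x w ≠ colF w y

instance (x y w : Fin 22) : Decidable (GoodMid x y w) := by unfold GoodMid; infer_instance

theorem good_pairs : ∀ x y : Fin 22, x ≠ y →
    (partN x ≠ partN y ∧ ∃ w, GoodMid x y w) ∨
    (∃ w₁, GoodMid x y w₁ ∧ ∃ w₂, w₁ ≠ w₂ ∧ GoodMid x y w₂) := by
  decide +kernel

/-- Numbering of the vertices. -/
def toN : (Σ i, (![Fin 2, Fin 4, Fin 16] : Fin 3 → Type) i) → Fin 22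
  | ⟨0, i⟩ => ⟨Fin.val (n := 2) i, by have := Fin.isLt (n := 2) i; omega⟩
  | ⟨1, i⟩ => ⟨2 + Fin.val (n := 4) i, by have := Fin.isLt (n := 4) i; omega⟩
  | ⟨2, i⟩ => ⟨6 + Fin.val (n := 16) i, by have := Fin.isLt (n := 16) i; omega⟩

theorem partN_toN (u) : partN (toN u) = u.1 := by
  obtain ⟨i, a⟩ := u
  fin_cases i
  · exact (by decide : ∀ a : Fin 2, partN (toN ⟨0, a⟩) = 0) a
  · exact (by decide : ∀ a : Fin 4, partN (toN ⟨1, a⟩) = 1) a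
  · exact (by decide : ∀ a : Fin 16, partN (toN ⟨2, a⟩) = 2) a

theorem toN_inj : Function.Injective toN := by
  intro u v h
  have hp : u.1 = v.1 := by rw [← partN_toN, ← partN_toN, h]
  obtain ⟨i, a⟩ := u
  obtain ⟨j, b⟩ := v
  simp only at hp
  subst hp
  congr 1
  fin_cases i
  · exact Fin.ext (n := 2) (by simpa [toN] using h)
  · exact Fin.ext (n := 4) (by simpa [toN] using h)
  · exact Fin.ext (n := 16) (by simpa [toN] using h)

theorem toN_surj (x : Fin 22) : ∃ u, toN u = x := by
  by_cases h1 : x.1 < 2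
  · exact ⟨⟨0, (⟨x.1, h1⟩ : Fin 2)⟩, rfl⟩
  by_cases h2 : x.1 < 6
  · exact ⟨⟨1, (⟨x.1 - 2, by omega⟩ : Fin 4)⟩, Fin.ext (by simp [toN]; omega)⟩
  · exact ⟨⟨2, (⟨x.1 - 6, by omega⟩ : Fin 16)⟩, Fin.ext (by simp [toN]; omega)⟩

theorem adj_iff (u v) : KG.Adj u v ↔ partN (toN u) ≠ partN (toN v) := by
  rw [partN_toN, partN_toN]; rfl

/-- The colouring. -/
def colC : Sym2 (Σ i, (![Fin 2, Fin 4, Fin 16] : Fin 3 → Type) i) → Fin 2 :=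
  Sym2.lift ⟨fun u v => colF (toN u) (toN v), fun _ _ => colF_symm _ _⟩

theorem two_path {V α : Type*} {G : SimpleGraph V} {c : Sym2 V → α} {u v w : V} (huv : u ≠ v)
    (h₁ : G.Adj u w) (h₂ : G.Adj w v) (hc : c s(u, w) ≠ c s(w, v)) :
    (Walk.cons h₁ (Walk.cons h₂ Walk.nil)).IsPath ∧
      (Walk.cons h₁ (Walk.cons h₂ Walk.nil)).IsRainbow c := by
  constructor
  · simp [Walk.isPath_def, huv, h₁.ne, h₂.ne]
  · simp [Walk.IsRainbow, hc]

theorem two_le_length {V : Type*} {G : SimpleGraph V} {u v : V} (huv : u ≠ v)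
    (hn : ¬ G.Adj u v) (p : G.Walk u v) : 2 ≤ p.length := by
  cases p with
  | nil => exact absurd rfl huv
  | cons h q =>
    cases q with
    | nil => exact absurd h hn
    | cons h' q' => simp

theorem mk_pair {V α : Type*} {G : SimpleGraph V} {c : Sym2 V → α} {u v : V}
    (p q : G.Walk u v) (hpq : p ≠ q) (hp : p.IsPath ∧ p.IsRainbow c)
    (hq : q.IsPath ∧ q.IsRainbow c)
    (hd : ∀ w, w ∈ p.support → w ∈ q.support → w = u ∨ w = v) :
    ∃ P : Fin 2 → G.Walk u v, Function.Injective P ∧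
    (∀ i, (P i).IsPath ∧ (P i).IsRainbow c) ∧
    (∀ i j, i ≠ j → ∀ w, w ∈ (P i).support → w ∈ (P j).support → w = u ∨ w = v) := by
  refine ⟨![p, q], ?_, ?_, ?_⟩
  · intro i j h
    fin_cases i <;> fin_cases j <;> simp_all
  · intro i
    fin_cases i
    · exact hp
    · exact hq
  · intro i j h w
    fin_cases i <;> fin_cases j
    · exact absurd rfl h
    · exact hd w
    · exact fun a b => hd w b a
    · exact absurd rfl h

theorem rc_two_K_2_4_16_eq_two :
    RCle (completeMultipartiteGraph ![Fin 2, Fin 4, Fin 16]) 2 2 ∧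
    ¬ RCle (completeMultipartiteGraph ![Fin 2, Fin 4, Fin 16]) 2 1 := by
  constructor
  · refine ⟨colC, fun u v huv => ?_⟩
    have key : ∀ w, GoodMid (toN u) (toN v) (toN w) →
        ∃ (h₁ : KG.Adj u w) (h₂ : KG.Adj w v), colC s(u, w) ≠ colC s(w, v) :=
      fun w h => ⟨(adj_iff _ _).2 h.1, (adj_iff _ _).2 h.2.1, h.2.2⟩
    rcases good_pairs (toN u) (toN v) (fun h => huv (toN_inj h)) with
      ⟨ha, x, hx⟩ | ⟨x, hx, y, hxy, hy⟩
    · obtain ⟨w, rfl⟩ := toN_surj x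
      obtain ⟨h₁, h₂, hc⟩ := key w hx
      have hadj : KG.Adj u v := (adj_iff _ _).2 ha
      refine mk_pair (Walk.cons hadj Walk.nil) (Walk.cons h₁ (Walk.cons h₂ Walk.nil)) ?_ ?_
        (two_path huv h₁ h₂ hc) ?_
      · intro h
        have := congrArg Walk.length h
        simp at this
      · constructor
        · simp [Walk.isPath_def, huv]
        · simp [Walk.IsRainbow]
      · intro z hz _
        simpa using hz
    · obtain ⟨w, rfl⟩ := toN_surj x
      obtain ⟨w', rfl⟩ := toN_surj y
      obtain ⟨h₁, h₂, hc⟩ := key w hx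
      obtain ⟨h₁', h₂', hc'⟩ := key w' hy
      have hne : w ≠ w' := fun h => hxy (by rw [h])
      refine mk_pair (Walk.cons h₁ (Walk.cons h₂ Walk.nil))
        (Walk.cons h₁' (Walk.cons h₂' Walk.nil)) ?_
        (two_path huv h₁ h₂ hc) (two_path huv h₁' h₂' hc') ?_
      · intro h
        have := congrArg Walk.support h
        simp at this
        exact hne this
      · intro z hz hz'
        simp only [Walk.support_cons, Walk.support_nil, List.mem_cons, List.not_mem_nil,
          or_false] at hz hz'
        rcases hz with h | h | h
        · exact Or.inl h
        · rcases hz' with h' | h' | h'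
          · exact Or.inl h'
          · exact absurd (h.symm.trans h') hne
          · exact Or.inr h'
        · exact Or.inr h
  · rintro ⟨c, hc⟩
    let u : Σ i, (![Fin 2, Fin 4, Fin 16] : Fin 3 → Type) i := ⟨0, (0 : Fin 2)⟩
    let v : Σ i, (![Fin 2, Fin 4, Fin 16] : Fin 3 → Type) i := ⟨0, (1 : Fin 2)⟩
    have huv : u ≠ v := fun h => absurd (congrArg toN h) (by decide)
    obtain ⟨P, -, hP, -⟩ := hc u v huv
    have hr := (hP 0).2
    have hn : ¬ (completeMultipartiteGraph ![Fin 2, Fin 4, Fin 16]).Adj u v := fun h => h rfl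
    have hlen := List.Nodup.length_le_card hr
    simp only [List.length_map, Walk.length_edges, Fintype.card_fin] at hlen
    have := two_le_length huv hn (P 0)
    omega
end
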